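/- arXiv:0904.2401 — 2 statements merged into one kernel-verified Lean document; each statement's English description precedes it below -/
import Mathlib

section
/- Let N be a layered linear deterministic network over a field with node layers O_1,…,O_M. Then the cut capacity function Ω ↦ C(Ω) = Σ_{i=1}^{M−1} rank(G_i(Ω)) is submodular over all cuts Ω ⊆ O_1 ∪ ⋯ ∪ O_M: for all Ω_1, Ω_2, C(Ω_1) + C(Ω_2) ≥ C(Ω_1 ∩ Ω_2) + C(Ω_1 ∪ Ω_2). -/
open Matrix

/-- The rank of the block submatrix of `G` formed by the rows whose row-block index lies in `W`
and the columns whose column-block index lies in `U`. -/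
noncomputable def blockRank {F : Type*} [Field F] {ρ γ ι κ : Type*} [Fintype ρ] [Fintype γ]
    [DecidableEq ι] [DecidableEq κ]
    (G : Matrix ρ γ F) (rblk : ρ → κ) (cblk : γ → ι)
    (W : Finset κ) (U : Finset ι) : ℕ :=
  (G.submatrix (fun r : {r : ρ // rblk r ∈ W} => r.1)
               (fun c : {c : γ // cblk c ∈ U} => c.1)).rank

/-- A block matrix `G` supports the flow `(ℓ; ℓ')` of rate `R` if there is an invertible `R × R`
submatrix of `G` using exactly `ℓ j` columns from the `j`-th column block and exactly
`ℓ' k` rows from the `k`-th row block. -/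
def SupportsFlow {F : Type*} [Field F] {ρ γ ι κ : Type*} [DecidableEq ι] [DecidableEq κ]
    (G : Matrix ρ γ F) (rblk : ρ → κ) (cblk : γ → ι)
    (ℓ : ι → ℕ) (ℓ' : κ → ℕ) (R : ℕ) : Prop :=
  ∃ (r : Fin R → ρ) (c : Fin R → γ),
    Function.Injective r ∧ Function.Injective c ∧
    (∀ k : κ, (Finset.univ.filter fun i => rblk (r i) = k).card = ℓ' k) ∧
    (∀ j : ι, (Finset.univ.filter fun i => cblk (c i) = j).card = ℓ j) ∧
    IsUnit (G.submatrix r c)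

section Network

/- A layered linear deterministic network with `M + 1` layers indexed by `Fin (M+1)`, where layer
`i` has `m i` nodes, and for each hop `i : Fin M` a block matrix `G i` whose column blocks are
indexed by the nodes of layer `i.castSucc` and whose row blocks are indexed by the nodes of
layer `i.succ`. -/
variable {F : Type*} [Field F] {M : ℕ} {m : Fin (M + 1) → ℕ}
  {ρ γ : Fin M → Type*}

/-- The capacity `C(Ω) = ∑_i rank (G_i(Ω))` of a cut `Ω`, where `G_i(Ω)` consists of the column
blocks of `G i` indexed by `Ω ∩ O_i` and the row blocks indexed by `O_{i+1} ∖ Ω`. -/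
noncomputable def cutCap [∀ i, Fintype (ρ i)] [∀ i, Fintype (γ i)]
    (G : ∀ i : Fin M, Matrix (ρ i) (γ i) F)
    (rblk : ∀ i : Fin M, ρ i → Fin (m i.succ))
    (cblk : ∀ i : Fin M, γ i → Fin (m i.castSucc))
    (Ω : ∀ i : Fin (M + 1), Finset (Fin (m i))) : ℕ :=
  ∑ i : Fin M, blockRank (G i) (rblk i) (cblk i) ((Ω i.succ)ᶜ) (Ω i.castSucc)

/-- The network supports the rate-`R` flow `(ℓfirst; ℓlast)` if there are per-layer nonnegative
integers `ℓ i`, agreeing with `ℓfirst` on the first layer and with `ℓlast` on the last layer,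
such that every block matrix `G i` supports the flow `(ℓ i.castSucc; ℓ i.succ)` of rate `R`. -/
def NetSupports [∀ i, Fintype (ρ i)] [∀ i, Fintype (γ i)]
    (G : ∀ i : Fin M, Matrix (ρ i) (γ i) F)
    (rblk : ∀ i : Fin M, ρ i → Fin (m i.succ))
    (cblk : ∀ i : Fin M, γ i → Fin (m i.castSucc))
    (ℓfirst : Fin (m 0) → ℕ) (ℓlast : Fin (m (Fin.last M)) → ℕ) (R : ℕ) : Prop :=
  ∃ ℓ : ∀ i : Fin (M + 1), Fin (m i) → ℕ,
    ℓ 0 = ℓfirst ∧ ℓ (Fin.last M) = ℓlast ∧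
    ∀ i : Fin M, SupportsFlow (G i) (rblk i) (cblk i) (ℓ i.castSucc) (ℓ i.succ) R

end Network

theorem Submodule.finrank_map_add_finrank_ker_eq_finrank_sup {F V V' : Type*} [Field F]
    [AddCommGroup V] [Module F V] [AddCommGroup V'] [Module F V'] [FiniteDimensional F V]
    (f : V →ₗ[F] V') (S : Submodule F V) :
    Module.finrank F (S.map f) + Module.finrank F (LinearMap.ker f) =
      Module.finrank F ↥(S ⊔ LinearMap.ker f) := by
  have h := LinearMap.finrank_range_add_finrank_ker (f.domRestrict (S ⊔ LinearMap.ker f))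
  have hrange : LinearMap.range (f.domRestrict (S ⊔ LinearMap.ker f)) = S.map f := by
    rw [LinearMap.range_domRestrict, Submodule.map_sup, sup_eq_left,
      (LinearMap.le_ker_iff_map (p := LinearMap.ker f)).1 le_rfl]
    exact bot_le
  have hker : Module.finrank F (LinearMap.ker (f.domRestrict (S ⊔ LinearMap.ker f))) =
      Module.finrank F (LinearMap.ker f) := by
    rw [LinearMap.ker_domRestrict]
    exact (Submodule.comapSubtypeEquivOfLe le_sup_right).finrank_eq
  rw [← h, hrange, hker]

section BlockRank

variable {F ρ γ ι κ : Type*} [Field F]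

/-- The vectors whose entries in the row blocks of `W` all vanish. -/
def vanishingOn (F : Type*) [Field F] (rblk : ρ → κ) (W : Finset κ) : Submodule F (ρ → F) :=
  LinearMap.ker (LinearMap.funLeft F F (fun r : {r : ρ // rblk r ∈ W} => r.1))

/-- The span of the columns of `G` that lie in the column blocks of `U`. -/
def columnSpan (G : Matrix ρ γ F) (cblk : γ → ι) (U : Finset ι) : Submodule F (ρ → F) :=
  Submodule.span F (G.col '' {c | cblk c ∈ U})

theorem mem_vanishingOn {rblk : ρ → κ} {W : Finset κ} {v : ρ → F} :
    v ∈ vanishingOn F rblk W ↔ ∀ r, rblk r ∈ W → v r = 0 := by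
  simp [vanishingOn, funext_iff, LinearMap.funLeft_apply]

theorem columnSpan_mono (G : Matrix ρ γ F) (cblk : γ → ι) {U U' : Finset ι} (h : U ⊆ U') :
    columnSpan G cblk U ≤ columnSpan G cblk U' :=
  Submodule.span_mono (Set.image_mono fun _ hc => h hc)

variable [DecidableEq ι] [DecidableEq κ]

theorem vanishingOn_union (rblk : ρ → κ) (W₁ W₂ : Finset κ) :
    vanishingOn F rblk (W₁ ∪ W₂) = vanishingOn F rblk W₁ ⊓ vanishingOn F rblk W₂ := by
  ext v
  simp only [Submodule.mem_inf, mem_vanishingOn, Finset.mem_union]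
  grind

theorem vanishingOn_inter (rblk : ρ → κ) (W₁ W₂ : Finset κ) :
    vanishingOn F rblk (W₁ ∩ W₂) = vanishingOn F rblk W₁ ⊔ vanishingOn F rblk W₂ := by
  apply le_antisymm
  · intro v hv
    rw [mem_vanishingOn] at hv
    refine Submodule.mem_sup.2 ⟨fun r => if rblk r ∈ W₁ then 0 else v r, ?_,
      fun r => if rblk r ∈ W₁ then v r else 0, ?_, ?_⟩
    · exact mem_vanishingOn.2 fun r hr => if_pos hr
    · refine mem_vanishingOn.2 fun r hr => ?_
      split_ifs with h
      · exact hv r (Finset.mem_inter.2 ⟨h, hr⟩)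
      · rfl
    · ext r
      by_cases h : rblk r ∈ W₁ <;> simp [h]
  · refine sup_le ?_ ?_ <;> intro v hv <;> rw [mem_vanishingOn] at hv ⊢ <;> intro r hr
    · exact hv r (Finset.mem_inter.1 hr).1
    · exact hv r (Finset.mem_inter.1 hr).2

theorem columnSpan_union (G : Matrix ρ γ F) (cblk : γ → ι) (U₁ U₂ : Finset ι) :
    columnSpan G cblk (U₁ ∪ U₂) = columnSpan G cblk U₁ ⊔ columnSpan G cblk U₂ := by
  simp only [columnSpan, ← Submodule.span_union, ← Set.image_union, Finset.mem_union,
    Set.ofPred_or]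

theorem blockRank_add_finrank_vanishingOn [Fintype ρ] [Fintype γ] (G : Matrix ρ γ F)
    (rblk : ρ → κ) (cblk : γ → ι) (W : Finset κ) (U : Finset ι) :
    blockRank G rblk cblk W U + Module.finrank F (vanishingOn F rblk W) =
      Module.finrank F ↥(columnSpan G cblk U ⊔ vanishingOn F rblk W) := by
  rw [vanishingOn, ← Submodule.finrank_map_add_finrank_ker_eq_finrank_sup, blockRank,
    Matrix.rank_eq_finrank_span_cols, columnSpan, Submodule.map_span, ← Set.image_comp,
    Set.image_eq_range]
  rfl

/-- The rank of a block submatrix is submodular when the row set is taken with reversed order. -/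
theorem blockRank_submodular [Fintype ρ] [Fintype γ] (G : Matrix ρ γ F)
    (rblk : ρ → κ) (cblk : γ → ι) (W₁ W₂ : Finset κ) (U₁ U₂ : Finset ι) :
    blockRank G rblk cblk (W₁ ∪ W₂) (U₁ ∩ U₂) + blockRank G rblk cblk (W₁ ∩ W₂) (U₁ ∪ U₂) ≤
      blockRank G rblk cblk W₁ U₁ + blockRank G rblk cblk W₂ U₂ := by
  have h₁ := blockRank_add_finrank_vanishingOn G rblk cblk W₁ U₁
  have h₂ := blockRank_add_finrank_vanishingOn G rblk cblk W₂ U₂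
  have hinf := blockRank_add_finrank_vanishingOn G rblk cblk (W₁ ∪ W₂) (U₁ ∩ U₂)
  have hsup := blockRank_add_finrank_vanishingOn G rblk cblk (W₁ ∩ W₂) (U₁ ∪ U₂)
  rw [vanishingOn_union] at hinf
  rw [vanishingOn_inter, columnSpan_union, sup_sup_sup_comm] at hsup
  have hvanish := Submodule.finrank_sup_add_finrank_inf_eq
    (vanishingOn F rblk W₁) (vanishingOn F rblk W₂)
  have hspan := Submodule.finrank_sup_add_finrank_inf_eq
    (columnSpan G cblk U₁ ⊔ vanishingOn F rblk W₁) (columnSpan G cblk U₂ ⊔ vanishingOn F rblk W₂)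
  have hle := Submodule.finrank_mono (R := F) <| le_inf
    (sup_le_sup (columnSpan_mono G cblk (Finset.inter_subset_left (s₁ := U₁) (s₂ := U₂)))
      (inf_le_left (a := vanishingOn F rblk W₁) (b := vanishingOn F rblk W₂)))
    (sup_le_sup (columnSpan_mono G cblk (Finset.inter_subset_right (s₁ := U₁) (s₂ := U₂)))
      inf_le_right)
  omega

end BlockRank

/-- **Lemma 10 (submodularity of the cut capacity).** For a layered linear deterministic network
over a field, the cut capacity `Ω ↦ C(Ω) = ∑_i rank (G_i(Ω))` is submodular over cuts
`Ω ⊆ O_1 ∪ ⋯ ∪ O_M`:  `C(Ω₁) + C(Ω₂) ≥ C(Ω₁ ∩ Ω₂) + C(Ω₁ ∪ Ω₂)`. -/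
theorem stmt_11 {F : Type*} [Field F] {M : ℕ}
    {m : Fin (M + 1) → ℕ} {ρ γ : Fin M → Type*}
    [∀ i, Fintype (ρ i)] [∀ i, Fintype (γ i)]
    (G : ∀ i : Fin M, Matrix (ρ i) (γ i) F)
    (rblk : ∀ i : Fin M, ρ i → Fin (m i.succ))
    (cblk : ∀ i : Fin M, γ i → Fin (m i.castSucc))
    (Ω₁ Ω₂ : ∀ i : Fin (M + 1), Finset (Fin (m i))) :
    cutCap G rblk cblk (fun i => Ω₁ i ∩ Ω₂ i) + cutCap G rblk cblk (fun i => Ω₁ i ∪ Ω₂ i) ≤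
      cutCap G rblk cblk Ω₁ + cutCap G rblk cblk Ω₂ := by
  simp only [cutCap, ← Finset.sum_add_distrib, Finset.compl_inter, Finset.compl_union]
  exact Finset.sum_le_sum fun i _ => blockRank_submodular _ _ _ _ _ _ _
end

section
/- Let F be a field, let G be a matrix over F with column blocks C_1,…,C_m and row blocks R_1,…,R_{m'}, and let d = (ℓ(1),…,ℓ(m); ℓ'(1),…,ℓ'(m')) be a flow vector of rate R such that G satisfies the rank conditions for d. Suppose T is a submatrix of G obtained by selecting a subset of rows and a subset of columns (retaining the block structure) such that T satisfies the rank conditions for d, and T is minimal in the sense that deleting any single row of T or any single column of T yields a matrix violating at least one rank condition for d. Then T has exactly R rows and exactly R columns, T has exactly ℓ(j) columns in the j-th column block and exactly ℓ'(k) rows in the k-th row block, and T is invertible; hence T is a solution for the flow d. -/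
open Matrix

/-- The rank of the block submatrix, of the submatrix of `G` on the rows in `Sr` and the columns
in `Sc` (with the inherited block structure), formed by the rows whose row-block index lies in
`W` and the columns whose column-block index lies in `U`. -/
noncomputable def rkSub {F : Type*} [Field F] {ρ γ ι κ : Type*} [Fintype ρ] [Fintype γ]
    [DecidableEq ρ] [DecidableEq γ] [DecidableEq ι] [DecidableEq κ]
    (G : Matrix ρ γ F) (rblk : ρ → κ) (cblk : γ → ι)
    (Sr : Finset ρ) (Sc : Finset γ) (W : Finset κ) (U : Finset ι) : ℕ :=
  (G.submatrix (fun r : {r : ρ // r ∈ Sr ∧ rblk r ∈ W} => r.1)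
               (fun c : {c : γ // c ∈ Sc ∧ cblk c ∈ U} => c.1)).rank

/-- The span of the columns of `G` indexed by `B` together with all vectors vanishing on `A`. -/
def colSpanMod {F ρ γ : Type*} [Field F] (G : Matrix ρ γ F) (A : Finset ρ) (B : Finset γ) :
    Submodule F (ρ → F) :=
  Submodule.span F (G.col '' B) ⊔ Submodule.pi (A : Set ρ) fun _ => ⊥

section ColSpanMod

variable {F ρ γ : Type*} [Field F]

theorem pi_bot_inter_le [DecidableEq ρ] (A₁ A₂ : Finset ρ) :
    (Submodule.pi ((A₁ ∩ A₂ : Finset ρ) : Set ρ) fun _ => (⊥ : Submodule F F)) ≤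
      (Submodule.pi (A₁ : Set ρ) fun _ => ⊥) ⊔ Submodule.pi (A₂ : Set ρ) fun _ => ⊥ := by
  intro x hx
  rw [Submodule.mem_sup]
  refine ⟨fun i => if i ∈ A₁ then 0 else x i, ?_, fun i => if i ∈ A₁ then x i else 0, ?_, ?_⟩
  · intro i hi
    simp_all
  · intro i hi
    by_cases h : i ∈ A₁
    · simpa [h] using hx i (by simp_all)
    · simp [h]
  · ext i
    by_cases h : i ∈ A₁ <;> simp [h]

theorem colSpanMod_mono (G : Matrix ρ γ F) {A₁ A₂ : Finset ρ} {B₁ B₂ : Finset γ}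
    (hA : A₂ ⊆ A₁) (hB : B₁ ⊆ B₂) : colSpanMod G A₁ B₁ ≤ colSpanMod G A₂ B₂ :=
  sup_le_sup (Submodule.span_mono (Set.image_mono (by exact_mod_cast hB)))
    fun _ hx i hi => hx i (hA hi)

theorem col_mem_colSpanMod (G : Matrix ρ γ F) (A : Finset ρ) {B : Finset γ} {c : γ}
    (hc : c ∈ B) : G.col c ∈ colSpanMod G A B :=
  Submodule.mem_sup_left (Submodule.subset_span ⟨c, hc, rfl⟩)

variable [Fintype ρ]

theorem finrank_colSpanMod_submodular [DecidableEq ρ] [DecidableEq γ] (G : Matrix ρ γ F)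
    (A₁ A₂ : Finset ρ) (B₁ B₂ : Finset γ) :
    Module.finrank F (colSpanMod G (A₁ ∪ A₂) (B₁ ∩ B₂)) +
        Module.finrank F (colSpanMod G (A₁ ∩ A₂) (B₁ ∪ B₂)) ≤
      Module.finrank F (colSpanMod G A₁ B₁) + Module.finrank F (colSpanMod G A₂ B₂) := by
  rw [← Submodule.finrank_sup_add_finrank_inf_eq (colSpanMod G A₁ B₁), add_comm]
  refine add_le_add (Submodule.finrank_mono ?_) (Submodule.finrank_mono (le_inf ?_ ?_))
  · refine sup_le (Submodule.span_le.2 ?_) ((pi_bot_inter_le A₁ A₂).trans ?_)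
    · rintro _ ⟨c, hc, rfl⟩
      rcases Finset.mem_union.1 (Finset.mem_coe.1 hc) with h | h
      · exact Submodule.mem_sup_left (col_mem_colSpanMod G A₁ h)
      · exact Submodule.mem_sup_right (col_mem_colSpanMod G A₂ h)
    · exact sup_le_sup le_sup_right le_sup_right
  · exact colSpanMod_mono G Finset.subset_union_left Finset.inter_subset_left
  · exact colSpanMod_mono G Finset.subset_union_right Finset.inter_subset_right

theorem finrank_colSpanMod_le_erase_add_one [DecidableEq γ] (G : Matrix ρ γ F) (A : Finset ρ)
    (B : Finset γ) (c : γ) :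
    Module.finrank F (colSpanMod G A B) ≤ Module.finrank F (colSpanMod G A (B.erase c)) + 1 := by
  have hle : colSpanMod G A B ≤
      colSpanMod G A (B.erase c) ⊔ Submodule.span F {G.col c} := by
    refine sup_le (Submodule.span_le.2 ?_) (le_sup_right.trans le_sup_left)
    rintro _ ⟨b, hb, rfl⟩
    by_cases h : b = c
    · subst h
      exact Submodule.mem_sup_right (Submodule.mem_span_singleton_self _)
    · exact Submodule.mem_sup_left
        (col_mem_colSpanMod G A (Finset.mem_erase.2 ⟨h, Finset.mem_coe.1 hb⟩))
  calc Module.finrank F (colSpanMod G A B)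
      ≤ _ := Submodule.finrank_mono hle
    _ ≤ _ := Submodule.finrank_add_le_finrank_add_finrank _ _
    _ ≤ _ := Nat.add_le_add_left
      (by simpa using finrank_span_le_card (R := F) ({G.col c} : Set (ρ → F))) _

/-- Removing a set of columns each of which lies outside the span of all the other ones lowers the
dimension by at least its cardinality. -/
theorem finrank_colSpanMod_sdiff_add_card_le [DecidableEq γ] (G : Matrix ρ γ F)
    (A : Finset ρ) (B D : Finset γ) (hDB : D ⊆ B) (hD : ∀ c ∈ D, G.col c ∉ colSpanMod G A (B.erase c)) :
    Module.finrank F (colSpanMod G A (B \ D)) + D.card ≤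
      Module.finrank F (colSpanMod G A B) := by
  induction D using Finset.induction_on with
  | empty => rw [Finset.sdiff_empty, Finset.card_empty, add_zero]
  | insert c D hc ih =>
    have ih' := ih (fun x hx => hDB (Finset.mem_insert_of_mem hx))
      fun x hx => hD x (Finset.mem_insert_of_mem hx)
    have hlt : colSpanMod G A (B \ insert c D) < colSpanMod G A (B \ D) := by
      refine lt_of_le_of_ne (colSpanMod_mono G subset_rfl
        (Finset.sdiff_subset_sdiff subset_rfl (Finset.subset_insert c D))) fun heq => ?_
      refine hD c (Finset.mem_insert_self c D) ?_
      have hmem : G.col c ∈ colSpanMod G A (B \ insert c D) := by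
        rw [heq]
        exact col_mem_colSpanMod G A
          (Finset.mem_sdiff.2 ⟨hDB (Finset.mem_insert_self c D), hc⟩)
      refine colSpanMod_mono G subset_rfl (fun x hx => ?_) hmem
      simp only [Finset.mem_sdiff, Finset.mem_insert, not_or] at hx
      exact Finset.mem_erase.2 ⟨hx.2.1, hx.1⟩
    have := Submodule.finrank_lt_finrank_of_lt hlt
    rw [Finset.card_insert_of_notMem hc]
    omega

theorem finrank_colSpanMod (G : Matrix ρ γ F) (A : Finset ρ) (B : Finset γ)
    {α β : Type*} [Fintype α] [Fintype β] (e : α → ρ) (f : β → γ)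
    (he : Function.Injective e) (heA : Set.range e = A) (hfB : Set.range f = B) :
    Module.finrank F (colSpanMod G A B) + A.card =
      (G.submatrix e f).rank + Fintype.card ρ := by
  set p := LinearMap.funLeft F F e
  have hker : LinearMap.ker p = Submodule.pi (A : Set ρ) fun _ => ⊥ := by
    ext x
    simp only [LinearMap.mem_ker, Submodule.mem_pi, Submodule.mem_bot, ← heA,
      Set.forall_mem_range]
    exact funext_iff
  have hA : Fintype.card α = A.card := by
    rw [← Set.ncard_coe_finset A, ← heA, Set.ncard_range_of_injective he,
      Nat.card_eq_fintype_card]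
  have hsurj : Function.Surjective p := LinearMap.funLeft_surjective_of_injective F F e he
  have hp := p.finrank_range_add_finrank_ker
  rw [LinearMap.range_eq_top.2 hsurj, finrank_top, Module.finrank_fintype_fun_eq_card,
    Module.finrank_fintype_fun_eq_card, hA] at hp
  have hcol : Set.range (G.submatrix e f).col = p '' (G.col '' B) := by
    rw [← hfB, ← Set.range_comp, ← Set.range_comp]
    rfl
  have hmap : (colSpanMod G A B).map p = Submodule.span F (Set.range (G.submatrix e f).col) := by
    rw [colSpanMod, ← hker, Submodule.map_sup, Submodule.map_span, hcol,
      (LinearMap.le_ker_iff_map).1 le_rfl, sup_bot_eq]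
  have hle : LinearMap.ker p ≤ colSpanMod G A B := hker ▸ le_sup_right
  have hq := (p.domRestrict (colSpanMod G A B)).finrank_range_add_finrank_ker
  rw [LinearMap.range_domRestrict, hmap, ← Matrix.rank_eq_finrank_span_cols,
    LinearMap.ker_domRestrict,
    (Submodule.comapSubtypeEquivOfLe hle).finrank_eq] at hq
  omega

end ColSpanMod

section RankConditions

variable {F : Type*} [Field F] {ρ γ ι κ : Type*} [Fintype ρ] [Fintype γ]
  [DecidableEq ρ] [DecidableEq γ] [DecidableEq ι] [DecidableEq κ]

theorem rkSub_transpose (G : Matrix ρ γ F) (rblk : ρ → κ) (cblk : γ → ι)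
    (Sr : Finset ρ) (Sc : Finset γ) (W : Finset κ) (U : Finset ι) :
    rkSub Gᵀ cblk rblk Sc Sr U W = rkSub G rblk cblk Sr Sc W U := by
  rw [rkSub, rkSub, ← Matrix.rank_transpose]
  rfl

theorem finrank_colSpanMod_filter (G : Matrix ρ γ F) (rblk : ρ → κ) (cblk : γ → ι)
    (Sr : Finset ρ) (Sc : Finset γ) (W : Finset κ) (U : Finset ι) :
    Module.finrank F (colSpanMod G (Sr.filter (rblk · ∈ W)) (Sc.filter (cblk · ∈ U))) +
      (Sr.filter (rblk · ∈ W)).card = rkSub G rblk cblk Sr Sc W U + Fintype.card ρ :=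
  finrank_colSpanMod G _ _ _ _ Subtype.val_injective (by ext; simp) (by ext; simp)

theorem rkSub_submodular (G : Matrix ρ γ F) (rblk : ρ → κ) (cblk : γ → ι)
    (Sr : Finset ρ) (Sc : Finset γ) (W₁ W₂ : Finset κ) (U₁ U₂ : Finset ι) :
    rkSub G rblk cblk Sr Sc (W₁ ∪ W₂) (U₁ ∩ U₂) + rkSub G rblk cblk Sr Sc (W₁ ∩ W₂) (U₁ ∪ U₂) ≤
      rkSub G rblk cblk Sr Sc W₁ U₁ + rkSub G rblk cblk Sr Sc W₂ U₂ := by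
  have h₁ := finrank_colSpanMod_filter G rblk cblk Sr Sc W₁ U₁
  have h₂ := finrank_colSpanMod_filter G rblk cblk Sr Sc W₂ U₂
  have h₃ := finrank_colSpanMod_filter G rblk cblk Sr Sc (W₁ ∪ W₂) (U₁ ∩ U₂)
  have h₄ := finrank_colSpanMod_filter G rblk cblk Sr Sc (W₁ ∩ W₂) (U₁ ∪ U₂)
  have hs := finrank_colSpanMod_submodular G (Sr.filter (rblk · ∈ W₁)) (Sr.filter (rblk · ∈ W₂))
    (Sc.filter (cblk · ∈ U₁)) (Sc.filter (cblk · ∈ U₂))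
  have hc := Finset.card_union_add_card_inter (Sr.filter (rblk · ∈ W₁))
    (Sr.filter (rblk · ∈ W₂))
  have e₁ : Sr.filter (rblk · ∈ W₁ ∪ W₂) =
      Sr.filter (rblk · ∈ W₁) ∪ Sr.filter (rblk · ∈ W₂) := by
    ext; simp; tauto
  have e₂ : Sr.filter (rblk · ∈ W₁ ∩ W₂) =
      Sr.filter (rblk · ∈ W₁) ∩ Sr.filter (rblk · ∈ W₂) := by
    ext; simp; tauto
  have e₃ : Sc.filter (cblk · ∈ U₁ ∪ U₂) =
      Sc.filter (cblk · ∈ U₁) ∪ Sc.filter (cblk · ∈ U₂) := by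
    ext; simp; tauto
  have e₄ : Sc.filter (cblk · ∈ U₁ ∩ U₂) =
      Sc.filter (cblk · ∈ U₁) ∩ Sc.filter (cblk · ∈ U₂) := by
    ext; simp; tauto
  rw [e₁, e₄] at h₃
  rw [e₂, e₃] at h₄
  omega

theorem rkSub_le_card_cols (G : Matrix ρ γ F) (rblk : ρ → κ) (cblk : γ → ι)
    (Sr : Finset ρ) (Sc : Finset γ) (W : Finset κ) (U : Finset ι) :
    rkSub G rblk cblk Sr Sc W U ≤ (Sc.filter (cblk · ∈ U)).card := by
  refine (Matrix.rank_le_card_width _).trans_eq ?_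
  rw [Fintype.card_subtype]
  congr 1
  ext
  simp

variable (G : Matrix ρ γ F) (rblk : ρ → κ) (cblk : γ → ι) (ℓ : ι → ℕ) (ℓ' : κ → ℕ) (R : ℕ)
  (Sr : Finset ρ) (Sc : Finset γ)

/-- A violated rank condition after deleting the column `c` yields a tight rank condition in which
the column `c` is independent of the others. -/
theorem exists_tight_of_erase
    (hT : ∀ (U : Finset ι) (W : Finset κ),
      ∑ j ∈ U, ℓ j + ∑ k ∈ W, ℓ' k ≤ rkSub G rblk cblk Sr Sc W U + R)
    {c : γ} (hc : ∃ (U : Finset ι) (W : Finset κ),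
      rkSub G rblk cblk Sr (Sc.erase c) W U + R < ∑ j ∈ U, ℓ j + ∑ k ∈ W, ℓ' k) :
    ∃ (U : Finset ι) (W : Finset κ), cblk c ∈ U ∧
      ∑ j ∈ U, ℓ j + ∑ k ∈ W, ℓ' k = rkSub G rblk cblk Sr Sc W U + R ∧
      G.col c ∉ colSpanMod G (Sr.filter (rblk · ∈ W)) ((Sc.filter (cblk · ∈ U)).erase c) := by
  obtain ⟨U, W, h⟩ := hc
  have hUW := hT U W
  have h₁ := finrank_colSpanMod_filter G rblk cblk Sr Sc W U
  have h₂ := finrank_colSpanMod_filter G rblk cblk Sr (Sc.erase c) W U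
  rw [Finset.filter_erase] at h₂
  have h₃ := finrank_colSpanMod_le_erase_add_one G (Sr.filter (rblk · ∈ W))
    (Sc.filter (cblk · ∈ U)) c
  refine ⟨U, W, ?_, by omega, fun hmem => ?_⟩
  · by_contra hcU
    rw [Finset.erase_eq_of_notMem (by simp [hcU])] at h₂
    omega
  · have hle : colSpanMod G (Sr.filter (rblk · ∈ W)) (Sc.filter (cblk · ∈ U)) ≤
        colSpanMod G (Sr.filter (rblk · ∈ W)) ((Sc.filter (cblk · ∈ U)).erase c) := by
      refine sup_le (Submodule.span_le.2 ?_) le_sup_right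
      rintro _ ⟨b, hb, rfl⟩
      by_cases hbc : b = c
      · exact hbc ▸ hmem
      · exact col_mem_colSpanMod G _ (Finset.mem_erase.2 ⟨hbc, Finset.mem_coe.1 hb⟩)
    have := Submodule.finrank_mono hle
    omega

theorem exists_tight_of_forall_erase
    (hT : ∀ (U : Finset ι) (W : Finset κ),
      ∑ j ∈ U, ℓ j + ∑ k ∈ W, ℓ' k ≤ rkSub G rblk cblk Sr Sc W U + R)
    (j : ι) {D : Finset γ} (hD : D.Nonempty) (hDj : ∀ c ∈ D, cblk c = j)
    (hc : ∀ c ∈ D, ∃ (U : Finset ι) (W : Finset κ),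
      rkSub G rblk cblk Sr (Sc.erase c) W U + R < ∑ j ∈ U, ℓ j + ∑ k ∈ W, ℓ' k) :
    ∃ (U : Finset ι) (W : Finset κ), j ∈ U ∧
      ∑ j ∈ U, ℓ j + ∑ k ∈ W, ℓ' k = rkSub G rblk cblk Sr Sc W U + R ∧
      ∀ c ∈ D,
        G.col c ∉ colSpanMod G (Sr.filter (rblk · ∈ W)) ((Sc.filter (cblk · ∈ U)).erase c) := by
  induction hD using Finset.Nonempty.cons_induction with
  | singleton c =>
    simpa [hDj c (by simp)] using
      exists_tight_of_erase G rblk cblk ℓ ℓ' R Sr Sc hT (hc c (by simp))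
  | cons c D hcD hD ih =>
    obtain ⟨U₁, W₁, hj₁, ht₁, hn₁⟩ :=
      exists_tight_of_erase G rblk cblk ℓ ℓ' R Sr Sc hT (hc c (by simp))
    obtain ⟨U₂, W₂, hj₂, ht₂, hn₂⟩ := ih (fun x hx => hDj x (by simp [hx]))
      fun x hx => hc x (by simp [hx])
    rw [hDj c (by simp)] at hj₁
    have hs := rkSub_submodular G rblk cblk Sr Sc W₁ W₂ U₁ U₂
    have ha := hT (U₁ ∩ U₂) (W₁ ∪ W₂)
    have hb := hT (U₁ ∪ U₂) (W₁ ∩ W₂)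
    have hU := Finset.sum_union_inter (s₁ := U₁) (s₂ := U₂) (f := ℓ)
    have hW := Finset.sum_union_inter (s₁ := W₁) (s₂ := W₂) (f := ℓ')
    refine ⟨U₁ ∩ U₂, W₁ ∪ W₂, Finset.mem_inter.2 ⟨hj₁, hj₂⟩, by omega, fun x hx hmem => ?_⟩
    have hmono : ∀ (U : Finset ι) (W : Finset κ), U₁ ∩ U₂ ⊆ U → W ⊆ W₁ ∪ W₂ →
        G.col x ∈ colSpanMod G (Sr.filter (rblk · ∈ W)) ((Sc.filter (cblk · ∈ U)).erase x) :=
      fun U W hU hW => colSpanMod_mono G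
        (Finset.monotone_filter_right _ fun _ _ h => hW h)
        (Finset.erase_subset_erase _ (Finset.monotone_filter_right _ fun _ _ h => hU h)) hmem
    rcases Finset.mem_cons.1 hx with rfl | hx
    · exact hn₁ (hmono U₁ W₁ Finset.inter_subset_left Finset.subset_union_left)
    · exact hn₂ x hx (hmono U₂ W₂ Finset.inter_subset_right Finset.subset_union_right)

/-- In a matrix satisfying the rank conditions from which no column can be deleted, every column
block has exactly the prescribed number of columns. -/
theorem card_colBlock_eq [Fintype κ] (hℓ' : ∑ k, ℓ' k = R)
    (hT : ∀ (U : Finset ι) (W : Finset κ),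
      ∑ j ∈ U, ℓ j + ∑ k ∈ W, ℓ' k ≤ rkSub G rblk cblk Sr Sc W U + R)
    (hcolmin : ∀ c ∈ Sc, ∃ (U : Finset ι) (W : Finset κ),
      rkSub G rblk cblk Sr (Sc.erase c) W U + R < ∑ j ∈ U, ℓ j + ∑ k ∈ W, ℓ' k)
    (j : ι) : (Sc.filter fun c => cblk c = j).card = ℓ j := by
  refine le_antisymm ?_ ?_
  · rcases (Sc.filter fun c => cblk c = j).eq_empty_or_nonempty with h | h
    · simp [h]
    obtain ⟨U, W, hj, ht, hn⟩ := exists_tight_of_forall_erase G rblk cblk ℓ ℓ' R Sr Sc hT j h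
      (fun c hc => (Finset.mem_filter.1 hc).2) fun c hc => hcolmin c (Finset.mem_filter.1 hc).1
    have hsub : (Sc.filter fun c => cblk c = j) ⊆ Sc.filter (cblk · ∈ U) :=
      Finset.monotone_filter_right _ fun _ _ h => h ▸ hj
    have hle := finrank_colSpanMod_sdiff_add_card_le G (Sr.filter (rblk · ∈ W)) _ _ hsub hn
    have hsdiff : Sc.filter (cblk · ∈ U) \ Sc.filter (cblk · = j) =
        Sc.filter (cblk · ∈ U.erase j) := by
      ext
      simp
      tauto
    rw [hsdiff] at hle
    have h₁ := finrank_colSpanMod_filter G rblk cblk Sr Sc W U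
    have h₂ := finrank_colSpanMod_filter G rblk cblk Sr Sc W (U.erase j)
    have h₃ := hT (U.erase j) W
    have h₄ := Finset.sum_erase_add U ℓ hj
    omega
  · have h₁ := hT {j} Finset.univ
    have h₂ := rkSub_le_card_cols G rblk cblk Sr Sc Finset.univ {j}
    simp only [Finset.mem_singleton, Finset.sum_singleton] at h₁ h₂
    omega

end RankConditions

/-- **Correctness of the row/column-removal algorithm.** Let `G` be a block matrix over a field
satisfying the rank conditions for a flow `d = (ℓ; ℓ')` of rate `R`.  Suppose `T` is a submatrix
of `G`, given by a set `Sr` of rows and a set `Sc` of columns (retaining the block structure),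
which satisfies the rank conditions for `d`, and which is minimal in the sense that deleting any
single row or any single column of `T` violates at least one rank condition.  Then `T` has
exactly `R` rows and `R` columns, `T` has exactly `ℓ j` columns in the `j`-th column block and
exactly `ℓ' k` rows in the `k`-th row block, and `T` is invertible; hence `T` is a solution for
the flow `d`. -/
theorem stmt_14 {F : Type*} [Field F] {ρ γ : Type*} [Fintype ρ] [Fintype γ]
    [DecidableEq ρ] [DecidableEq γ] {m m' : ℕ}
    (G : Matrix ρ γ F) (rblk : ρ → Fin m') (cblk : γ → Fin m)
    (ℓ : Fin m → ℕ) (ℓ' : Fin m' → ℕ) (R : ℕ)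
    (hℓ : ∑ j, ℓ j = R) (hℓ' : ∑ k, ℓ' k = R)
    (hG : ∀ (U : Finset (Fin m)) (W : Finset (Fin m')),
      ∑ j ∈ U, ℓ j + ∑ k ∈ W, ℓ' k ≤ rkSub G rblk cblk Finset.univ Finset.univ W U + R)
    (Sr : Finset ρ) (Sc : Finset γ)
    (hT : ∀ (U : Finset (Fin m)) (W : Finset (Fin m')),
      ∑ j ∈ U, ℓ j + ∑ k ∈ W, ℓ' k ≤ rkSub G rblk cblk Sr Sc W U + R)
    (hrowmin : ∀ r ∈ Sr, ∃ (U : Finset (Fin m)) (W : Finset (Fin m')),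
      rkSub G rblk cblk (Sr.erase r) Sc W U + R < ∑ j ∈ U, ℓ j + ∑ k ∈ W, ℓ' k)
    (hcolmin : ∀ c ∈ Sc, ∃ (U : Finset (Fin m)) (W : Finset (Fin m')),
      rkSub G rblk cblk Sr (Sc.erase c) W U + R < ∑ j ∈ U, ℓ j + ∑ k ∈ W, ℓ' k) :
    Sr.card = R ∧ Sc.card = R ∧
    (∀ j : Fin m, (Sc.filter fun c => cblk c = j).card = ℓ j) ∧
    (∀ k : Fin m', (Sr.filter fun r => rblk r = k).card = ℓ' k) ∧
    ∃ (r : Fin R → ρ) (c : Fin R → γ),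
      Function.Injective r ∧ Function.Injective c ∧
      (∀ i, r i ∈ Sr) ∧ (∀ i, c i ∈ Sc) ∧
      IsUnit (G.submatrix r c) := by
  have hcol := card_colBlock_eq G rblk cblk ℓ ℓ' R Sr Sc hℓ' hT hcolmin
  have hrow := card_colBlock_eq Gᵀ cblk rblk ℓ' ℓ R Sc Sr hℓ
    (fun W U => by
      rw [rkSub_transpose, add_comm (∑ k ∈ W, ℓ' k)]
      exact hT U W)
    (fun r hr => by
      obtain ⟨U, W, h⟩ := hrowmin r hr
      exact ⟨W, U, by rwa [rkSub_transpose, add_comm (∑ k ∈ W, ℓ' k)]⟩)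
  have hSr : Sr.card = R := by
    rw [Finset.card_eq_sum_card_fiberwise (f := rblk) (t := Finset.univ) (by simp), ← hℓ']
    exact Finset.sum_congr rfl fun k _ => hrow k
  have hSc : Sc.card = R := by
    rw [Finset.card_eq_sum_card_fiberwise (f := cblk) (t := Finset.univ) (by simp), ← hℓ]
    exact Finset.sum_congr rfl fun j _ => hcol j
  refine ⟨hSr, hSc, hcol, hrow, fun i => ((Sr.equivFinOfCardEq hSr).symm i).1,
    fun i => ((Sc.equivFinOfCardEq hSc).symm i).1,
    Subtype.val_injective.comp (Equiv.injective _),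
    Subtype.val_injective.comp (Equiv.injective _), fun i => Subtype.property _,
    fun i => Subtype.property _, ?_⟩
  set r : Fin R → ρ := fun i => ((Sr.equivFinOfCardEq hSr).symm i).1
  set c : Fin R → γ := fun i => ((Sc.equivFinOfCardEq hSc).symm i).1
  have hr : Set.range r = Sr := by
    change Set.range (Subtype.val ∘ (Sr.equivFinOfCardEq hSr).symm) = _
    simp [Set.range_comp]
  have hc : Set.range c = Sc := by
    change Set.range (Subtype.val ∘ (Sc.equivFinOfCardEq hSc).symm) = _
    simp [Set.range_comp]
  have h₁ := finrank_colSpanMod G Sr Sc r c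
    (Subtype.val_injective.comp (Equiv.injective _)) hr hc
  have h₂ := finrank_colSpanMod_filter G rblk cblk Sr Sc Finset.univ Finset.univ
  have h₃ := hT Finset.univ Finset.univ
  rw [Finset.filter_true_of_mem fun _ _ => Finset.mem_univ _,
    Finset.filter_true_of_mem fun _ _ => Finset.mem_univ _] at h₂
  rw [hℓ, hℓ'] at h₃
  rw [← Matrix.linearIndependent_cols_iff_isUnit, linearIndependent_iff_card_le_finrank_span,
    Set.finrank, ← Matrix.rank_eq_finrank_span_cols, Fintype.card_fin]
  omega
end
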